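/- Let n, l, s ≥ 1 be integers, d > s, and σ > 0. Let N ∈ ℝ^{n×s}, Z, Z' ∈ ℝ^{s×l} and G ∈ ℝ^{n×l} be independent standard Gaussian matrices, and let v ∈ ℝ^{n×s} be a deterministic matrix. Then D_KL(σ√(d−s) G + vZ', σ√(d−s) G + (σN + v)Z) ≤ nls / (2(d−s)). -/

import Mathlib

open MeasureTheory ProbabilityTheory Matrix Set

noncomputable section

namespace Paper

instance {m n : Type*} : MeasurableSpace (Matrix m n ℝ) :=
  inferInstanceAs (MeasurableSpace (m → n → ℝ))

def stdGaussianMatrix (m n : ℕ) : Measure (Matrix (Fin m) (Fin n) ℝ) :=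
  (Measure.pi fun _ : Fin m => Measure.pi fun _ : Fin n => gaussianReal 0 1)

open Classical in
/-- Kullback–Leibler divergence `KL(P ‖ Q) = ∫ log (dP/dQ) dP` when `P ≪ Q`, `+∞` otherwise. -/
def KLdiv {E : Type*} [MeasurableSpace E] (P Q : Measure E) : ENNReal :=
  if P ≪ Q then ENNReal.ofReal (∫ x, Real.log (P.rnDeriv Q x).toReal ∂P) else ⊤

lemma KLdiv_le_klDiv {E : Type*} [MeasurableSpace E] (P Q : Measure E) [IsProbabilityMeasure P]
    [IsProbabilityMeasure Q] : KLdiv P Q ≤ InformationTheory.klDiv P Q := by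
  by_cases h : InformationTheory.klDiv P Q = ⊤
  · simp [h]
  · obtain ⟨h1, h2⟩ := InformationTheory.klDiv_ne_top_iff.1 h
    rw [InformationTheory.klDiv_of_ac_of_integrable h1 h2, KLdiv, if_pos h1]
    simp [llr_def]

lemma pi_withDensity' {ι : Type*} [Fintype ι] {E : Type*} [MeasurableSpace E]
    (μ : Measure E) [IsProbabilityMeasure μ] (f : ι → E → ENNReal) (hf : ∀ i, Measurable (f i))
    [∀ i, SigmaFinite (μ.withDensity (f i))] :
    Measure.pi (fun i => μ.withDensity (f i)) =
      (Measure.pi (fun _ : ι => μ)).withDensity (fun x => ∏ i, f i (x i)) := by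
  refine Measure.pi_eq fun s hs => ?_
  rw [withDensity_apply _ (MeasurableSet.univ_pi hs),
    ← lintegral_indicator (MeasurableSet.univ_pi hs)]
  have h : ∀ x : ι → E, (Set.univ.pi s).indicator (fun x => ∏ i, f i (x i)) x
      = ∏ i, (s i).indicator (f i) (x i) := by
    intro x
    by_cases hx : x ∈ Set.univ.pi s
    · rw [indicator_of_mem hx]
      exact Finset.prod_congr rfl fun i _ => (indicator_of_mem (hx i trivial) _).symm
    · rw [indicator_of_notMem hx]
      simp only [Set.mem_pi, mem_univ, true_imp_iff, not_forall] at hx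
      obtain ⟨i, hi⟩ := hx
      exact (Finset.prod_eq_zero (Finset.mem_univ i) (indicator_of_notMem hi _)).symm
  simp_rw [h]
  have hm : ∀ i, Measurable ((s i).indicator (f i)) := fun i => (hf i).indicator (hs i)
  rw [lintegral_prod_eq_prod_lintegral_of_indepFun Finset.univ
    (fun i (x : ι → E) => (s i).indicator (f i) (x i))
    (iIndepFun_pi (μ := fun _ : ι => μ) (fun i => (hm i).aemeasurable))
    (fun i => (hm i).comp (measurable_pi_apply i))]
  refine Finset.prod_congr rfl fun i _ => ?_
  rw [withDensity_apply _ (hs i), ← lintegral_indicator (hs i)]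
  exact (measurePreserving_eval (fun _ : ι => μ) i).lintegral_comp (hm i)

/-- the Cameron-Martin density in dimension one -/
def cm (m x : ℝ) : ENNReal := ENNReal.ofReal (Real.exp (x * m - m ^ 2 / 2))

lemma measurable_cm (m : ℝ) : Measurable (cm m) := by unfold cm; fun_prop

lemma map_add_gaussian (m : ℝ) :
    (gaussianReal 0 1).map (· + m) = (gaussianReal 0 1).withDensity (cm m) := by
  rw [gaussianReal_map_add_const, gaussianReal_of_var_ne_zero _ one_ne_zero,
    gaussianReal_of_var_ne_zero _ one_ne_zero,
    ← withDensity_mul _ (measurable_gaussianPDF _ _) (measurable_cm m)]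
  congr 1
  ext x
  simp only [gaussianPDF, cm, Pi.mul_apply]
  rw [← ENNReal.ofReal_mul (gaussianPDFReal_nonneg _ _ _)]
  congr 1
  simp only [gaussianPDFReal]
  rw [mul_assoc _ (Real.exp _) (Real.exp _), ← Real.exp_add]
  congr 2
  simp
  ring

lemma map_add_pi {ι E : Type*} [Fintype ι] [MeasurableSpace E] [Add E] [MeasurableAdd E]
    (μ : Measure E) [IsProbabilityMeasure μ] (f : E → E → ENNReal) (hf : ∀ m, Measurable (f m))
    (h : ∀ m, μ.map (· + m) = μ.withDensity (f m)) (m : ι → E) :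
    (Measure.pi (fun _ : ι => μ)).map (· + m) =
      (Measure.pi (fun _ : ι => μ)).withDensity (fun x => ∏ i, f (m i) (x i)) := by
  have hp : ∀ i, IsProbabilityMeasure (μ.map (· + m i)) := fun i =>
    Measure.isProbabilityMeasure_map (by fun_prop)
  have hp' : ∀ i, IsProbabilityMeasure (μ.withDensity (f (m i))) := fun i => by
    rw [← h]; infer_instance
  rw [← pi_withDensity' μ _ (fun i => hf _)]
  simp_rw [← h]
  exact Measure.pi_map_pi (μ := fun _ : ι => μ) (f := fun i x => x + m i) (fun i => by fun_prop)

/-- The Gaussian measure on functions of two indices. -/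
abbrev γ (n l : ℕ) : Measure (Fin n → Fin l → ℝ) :=
  Measure.pi fun _ : Fin n => Measure.pi fun _ : Fin l => gaussianReal 0 1

/-- The log density -/
def ld {n l : ℕ} (m x : Fin n → Fin l → ℝ) : ℝ := ∑ i, ∑ j, (x i j * m i j - m i j ^ 2 / 2)

lemma map_add_γ {n l : ℕ} (m : Fin n → Fin l → ℝ) :
    (γ n l).map (· + m) = (γ n l).withDensity (fun x => ENNReal.ofReal (Real.exp (ld m x))) := by
  have h1 := fun m : Fin l → ℝ => map_add_pi (gaussianReal 0 1) cm measurable_cm map_add_gaussian m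
  have h2 := map_add_pi _ (fun (m : Fin l → ℝ) x => ∏ i, cm (m i) (x i))
    (fun m => Finset.measurable_fun_prod _ fun i _ => (measurable_cm _).comp (measurable_pi_apply i)) h1 m
  rw [h2]
  congr 1
  ext x
  simp only [cm, ld]
  simp_rw [Real.exp_sum]
  rw [ENNReal.ofReal_prod_of_nonneg (fun _ _ => by positivity)]
  refine Finset.prod_congr rfl fun i _ => ?_
  rw [ENNReal.ofReal_prod_of_nonneg (fun _ _ => by positivity)]

/-- Shift -/
lemma map_shift {n l : ℕ} {B : Type*} [MeasurableSpace B] (ν : Measure B) [IsProbabilityMeasure ν]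
    (M : B → Fin n → Fin l → ℝ) (hM : Measurable M) :
    ((γ n l).prod ν).map (fun ω => (ω.1 + M ω.2, ω.2)) =
      ((γ n l).prod ν).withDensity (fun ω => ENNReal.ofReal (Real.exp (ld (M ω.2) ω.1))) := by
  have hM' : ∀ i j, Measurable fun b => M b i j := fun i j => by fun_prop
  have hd : Measurable (fun ω : (Fin n → Fin l → ℝ) × B =>
      ENNReal.ofReal (Real.exp (ld (M ω.2) ω.1))) := by
    unfold ld; fun_prop
  refine Measure.ext_of_lintegral _ fun φ hφ => ?_
  rw [lintegral_map hφ (by fun_prop), lintegral_withDensity_eq_lintegral_mul _ hd hφ,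
    lintegral_prod_symm' _ (by fun_prop), lintegral_prod_symm' _ (by fun_prop)]
  refine lintegral_congr fun b => ?_
  have h := map_add_γ (M b)
  have h3 : ∫⁻ x, φ (x, b) ∂((γ n l).map (· + M b)) = _ := lintegral_map (by fun_prop) (by fun_prop)
  rw [← h3, h, lintegral_withDensity_eq_lintegral_mul _ (by unfold ld; fun_prop) (by fun_prop)]
  rfl

lemma klDiv_shift {n l : ℕ} {B : Type*} [MeasurableSpace B] (ν : Measure B) [IsProbabilityMeasure ν]
    (M : B → Fin n → Fin l → ℝ) (hM : Measurable M)
    (hint : Integrable (fun ω => - ld (M ω.2) ω.1) ((γ n l).prod ν)) :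
    InformationTheory.klDiv ((γ n l).prod ν) (((γ n l).prod ν).map (fun ω => (ω.1 + M ω.2, ω.2)))
      = ENNReal.ofReal (∫ ω, - ld (M ω.2) ω.1 ∂((γ n l).prod ν)) := by
  have hM' : ∀ i j, Measurable fun b => M b i j := fun i j => by fun_prop
  have hd : Measurable (fun ω : (Fin n → Fin l → ℝ) × B =>
      ENNReal.ofReal (Real.exp (ld (M ω.2) ω.1))) := by
    unfold ld; fun_prop
  have hpm : IsProbabilityMeasure (((γ n l).prod ν).map (fun ω => (ω.1 + M ω.2, ω.2))) :=
    Measure.isProbabilityMeasure_map (by fun_prop)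
  have hT := map_shift ν M hM
  set μ := (γ n l).prod ν
  set T := μ.map (fun ω => (ω.1 + M ω.2, ω.2))
  have h0 : ∀ᵐ ω ∂μ, ENNReal.ofReal (Real.exp (ld (M ω.2) ω.1)) ≠ 0 :=
    Filter.Eventually.of_forall fun ω => by simp [Real.exp_pos]
  have hac : μ ≪ T := by
    rw [hT]; exact withDensity_absolutelyContinuous' hd.aemeasurable h0
  have hl : llr μ T =ᵐ[μ] fun ω => - ld (M ω.2) ω.1 := by
    have h1 := Measure.rnDeriv_withDensity_right μ μ hd.aemeasurable h0
      (Filter.Eventually.of_forall fun ω => by simp)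
    filter_upwards [h1, Measure.rnDeriv_self μ] with ω h1 h2
    rw [llr_def, hT]
    simp only
    rw [h1, h2]
    simp [ENNReal.toReal_inv, Real.log_inv, ENNReal.toReal_ofReal (Real.exp_pos _).le]
  rw [InformationTheory.klDiv_of_ac_of_integrable hac ((integrable_congr hl).2 hint),
    integral_congr_ae hl]
  simp

lemma int_g : Integrable (fun x : ℝ => x) (gaussianReal 0 1) :=
  (memLp_id_gaussianReal' 1 (by simp)).integrable le_rfl

lemma memLp_g : MemLp (fun x : ℝ => x) 2 (gaussianReal 0 1) :=
  memLp_id_gaussianReal' 2 (by simp)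

lemma int_g2 : ∫ x : ℝ, x * x ∂(gaussianReal 0 1) = 1 := by
  have h := variance_id_gaussianReal (μ := 0) (v := 1)
  rw [variance_of_integral_eq_zero (by fun_prop) (by simp [integral_id_gaussianReal])] at h
  simpa [sq] using h

lemma memLp_γ {n l : ℕ} (i : Fin n) (j : Fin l) : MemLp (fun x => x i j) 2 (γ n l) :=
  (memLp_g.comp_measurePreserving (measurePreserving_eval (fun _ : Fin l => gaussianReal 0 1) j)).comp_measurePreserving
    (measurePreserving_eval (fun _ : Fin n => Measure.pi fun _ : Fin l => gaussianReal 0 1) i)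

lemma int_γ {n l : ℕ} (i : Fin n) (j : Fin l) : Integrable (fun x => x i j) (γ n l) :=
  (memLp_γ i j).integrable (by norm_num)

lemma integral_γ {n l : ℕ} (i : Fin n) (j : Fin l) : ∫ x, x i j ∂(γ n l) = 0 := by
  rw [integral_comp_eval (μ := fun _ : Fin n => Measure.pi fun _ : Fin l => gaussianReal 0 1)
    (i := i) (f := fun y : Fin l → ℝ => y j) (measurable_pi_apply j).aestronglyMeasurable, integral_comp_eval
    (μ := fun _ : Fin l => gaussianReal 0 1) (i := j) (f := fun y => y) (by fun_prop)]
  exact integral_id_gaussianReal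

lemma int2_γ {n l : ℕ} (i i' : Fin n) (j j' : Fin l) :
    Integrable (fun x => x i j * x i' j') (γ n l) :=
  (memLp_γ i j).integrable_mul (memLp_γ i' j')

lemma integral2_γ {n l : ℕ} (i : Fin n) (j j' : Fin l) :
    ∫ x, x i j * x i j' ∂(γ n l) = if j = j' then 1 else 0 := by
  rw [integral_comp_eval (μ := fun _ : Fin n => Measure.pi fun _ : Fin l => gaussianReal 0 1)
    (i := i) (f := fun y : Fin l → ℝ => y j * y j') (by fun_prop)]
  split_ifs with h
  · subst h
    rw [integral_comp_eval
      (μ := fun _ : Fin l => gaussianReal 0 1) (i := j) (f := fun y => y * y) (by fun_prop)]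
    exact int_g2
  · have hi := (iIndepFun_pi (μ := fun _ : Fin l => gaussianReal 0 1) (X := fun _ x => x)
      (fun i => by fun_prop)).indepFun h
    have := hi.integral_fun_mul_eq_mul_integral
      (measurable_pi_apply j).aestronglyMeasurable (measurable_pi_apply j').aestronglyMeasurable
    rw [this, integral_comp_eval
      (μ := fun _ : Fin l => gaussianReal 0 1) (i := j) (f := fun y => y) (by fun_prop)]
    simp [integral_id_gaussianReal]

lemma integral2'_γ {n l : ℕ} (i : Fin n) (j : Fin l) :
    ∫ x, x i j * x i j ∂(γ n l) = 1 := by simp [integral2_γ]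

/-- product -/
def MM {n l s : ℕ} (c : ℝ) (b : (Fin n → Fin s → ℝ) × (Fin s → Fin l → ℝ)) : Fin n → Fin l → ℝ :=
  fun i j => c * ∑ k, b.1 i k * b.2 k j

lemma int_MM {n l s : ℕ} (c : ℝ) (i : Fin n) (j : Fin l) :
    Integrable (fun b => MM c b i j) ((γ n s).prod (γ s l)) :=
  (integrable_finsetSum _ fun k _ => (int_γ i k).mul_prod (int_γ k j)).const_mul c

lemma MM_sq {n l s : ℕ} (c : ℝ) (i : Fin n) (j : Fin l)
    (b : (Fin n → Fin s → ℝ) × (Fin s → Fin l → ℝ)) :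
    MM c b i j ^ 2 = c ^ 2 * ∑ k, ∑ k', (b.1 i k * b.1 i k') * (b.2 k j * b.2 k' j) := by
  rw [MM, mul_pow, sq (∑ k, _), Finset.sum_mul_sum]
  congr 1
  refine Finset.sum_congr rfl fun k _ => Finset.sum_congr rfl fun k' _ => by ring

lemma int_MM_sq {n l s : ℕ} (c : ℝ) (i : Fin n) (j : Fin l) :
    Integrable (fun b => MM c b i j ^ 2) ((γ n s).prod (γ s l)) := by
  simp_rw [MM_sq]
  exact (integrable_finsetSum _ fun k _ => integrable_finsetSum _ fun k' _ =>
    (int2_γ i i k k').mul_prod (int2_γ k k' j j)).const_mul _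

lemma integral_MM_sq {n l s : ℕ} (c : ℝ) (i : Fin n) (j : Fin l) :
    ∫ b, MM c b i j ^ 2 ∂((γ n s).prod (γ s l)) = c ^ 2 * s := by
  simp_rw [MM_sq]
  rw [integral_const_mul, integral_finsetSum _ fun k _ => integrable_finsetSum _ fun k' _ =>
    (int2_γ i i k k').mul_prod (int2_γ k k' j j)]
  congr 1
  have : ∀ k : Fin s, ∫ b, ∑ k', (b.1 i k * b.1 i k') * (b.2 k j * b.2 k' j)
      ∂((γ n s).prod (γ s l)) = 1 := by
    intro k
    rw [integral_finsetSum _ fun k' _ => (int2_γ i i k k').mul_prod (int2_γ k k' j j)]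
    have h : ∀ k' : Fin s, ∫ b, (b.1 i k * b.1 i k') * (b.2 k j * b.2 k' j)
      ∂((γ n s).prod (γ s l)) = if k = k' then 1 else 0 := by
      intro k'
      rw [integral_prod_mul (fun x : Fin n → Fin s → ℝ => x i k * x i k')
        (fun y : Fin s → Fin l → ℝ => y k j * y k' j), integral2_γ]
      split_ifs with h
      · subst h; rw [integral2'_γ, mul_one]
      · simp
    simp [h]
  simp [this]

lemma int_term {n l s : ℕ} (c : ℝ) (i : Fin n) (j : Fin l) :
    Integrable (fun ω : (Fin n → Fin l → ℝ) × (Fin n → Fin s → ℝ) × (Fin s → Fin l → ℝ) =>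
      ω.1 i j * MM c ω.2 i j - MM c ω.2 i j ^ 2 / 2) ((γ n l).prod ((γ n s).prod (γ s l))) :=
  ((int_γ i j).mul_prod (int_MM c i j)).sub (((int_MM_sq c i j).div_const 2).comp_snd _)

lemma int_ld {n l s : ℕ} (c : ℝ) :
    Integrable (fun ω : (Fin n → Fin l → ℝ) × (Fin n → Fin s → ℝ) × (Fin s → Fin l → ℝ) =>
      - ld (MM c ω.2) ω.1) ((γ n l).prod ((γ n s).prod (γ s l))) :=
  (integrable_finsetSum _ fun i _ => integrable_finsetSum _ fun j _ => int_term c i j).neg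

lemma integral_ld {n l s : ℕ} (c : ℝ) :
    ∫ ω : (Fin n → Fin l → ℝ) × (Fin n → Fin s → ℝ) × (Fin s → Fin l → ℝ),
      - ld (MM c ω.2) ω.1 ∂((γ n l).prod ((γ n s).prod (γ s l))) = n * l * s * c ^ 2 / 2 := by
  unfold ld
  rw [integral_neg, integral_finsetSum _ fun i _ => integrable_finsetSum _ fun j _ => int_term c i j]
  simp_rw [integral_finsetSum _ fun j _ => int_term c _ j]
  have h : ∀ (i : Fin n) (j : Fin l), ∫ ω : (Fin n → Fin l → ℝ) × (Fin n → Fin s → ℝ) × (Fin s → Fin l → ℝ),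
      (ω.1 i j * MM c ω.2 i j - MM c ω.2 i j ^ 2 / 2) ∂((γ n l).prod ((γ n s).prod (γ s l)))
      = - (c ^ 2 * s / 2) := by
    intro i j
    rw [integral_sub ((int_γ i j).mul_prod (int_MM c i j))
      (((int_MM_sq c i j).div_const 2).comp_snd _),
      integral_prod_mul (fun x : Fin n → Fin l → ℝ => x i j)
        (fun b : (Fin n → Fin s → ℝ) × (Fin s → Fin l → ℝ) => MM c b i j), integral_γ,
      integral_fun_snd (fun b : (Fin n → Fin s → ℝ) × (Fin s → Fin l → ℝ) => MM c b i j ^ 2 / 2),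
      integral_div, integral_MM_sq]
    simp
  simp_rw [h]
  simp
  ring

lemma measurable_MM {n l s : ℕ} (c : ℝ) : Measurable (MM (n := n) (l := l) (s := s) c) := by
  unfold MM; fun_prop

lemma main_aux (n l s : ℕ) (a c : ℝ) (v : Fin n → Fin s → ℝ) :
    KLdiv
      (Measure.map
        (fun ω : (Fin n → Fin l → ℝ) × (Fin s → Fin l → ℝ) =>
          fun i j => a * ω.1 i j + ∑ k, v i k * ω.2 k j)
        ((γ n l).prod (γ s l)))
      (Measure.map
        (fun ω : (Fin n → Fin l → ℝ) × (Fin n → Fin s → ℝ) × (Fin s → Fin l → ℝ) =>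
          fun i j => a * ω.1 i j + ∑ k, (a * c * ω.2.1 i k + v i k) * ω.2.2 k j)
        ((γ n l).prod ((γ n s).prod (γ s l)))) ≤
    ENNReal.ofReal (n * l * s * c ^ 2 / 2) := by
  have hp1 := Measure.isProbabilityMeasure_map (μ := (γ n l).prod (γ s l))
    (f := fun ω : (Fin n → Fin l → ℝ) × (Fin s → Fin l → ℝ) =>
      fun i j => a * ω.1 i j + ∑ k, v i k * ω.2 k j) (by fun_prop)
  have hp2 := Measure.isProbabilityMeasure_map (μ := (γ n l).prod ((γ n s).prod (γ s l)))
    (f := fun ω : (Fin n → Fin l → ℝ) × (Fin n → Fin s → ℝ) × (Fin s → Fin l → ℝ) =>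
          fun i j => a * ω.1 i j + ∑ k, (a * c * ω.2.1 i k + v i k) * ω.2.2 k j) (by fun_prop)
  refine (KLdiv_le_klDiv _ _).trans ?_
  have hM := measurable_MM (n := n) (l := l) (s := s) c
  have hk := klDiv_shift ((γ n s).prod (γ s l)) (MM c) hM (int_ld c)
  rw [integral_ld] at hk
  rw [← hk]
  have hT : IsProbabilityMeasure (((γ n l).prod ((γ n s).prod (γ s l))).map
    (fun ω => (ω.1 + MM c ω.2, ω.2))) := Measure.isProbabilityMeasure_map (by fun_prop)
  let f : (Fin n → Fin l → ℝ) × (Fin n → Fin s → ℝ) × (Fin s → Fin l → ℝ) → Fin n → Fin l → ℝ :=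
    fun ω i j => a * ω.1 i j + ∑ k, v i k * ω.2.2 k j
  have hf : Measurable f := by fun_prop
  refine le_of_eq_of_le ?_ (InformationTheory.klDiv_map_le _ _ hf)
  congr 1
  · have h1 : (γ n l).prod (γ s l) =
        ((γ n l).prod ((γ n s).prod (γ s l))).map (Prod.map id Prod.snd) := by
      rw [← Measure.map_prod_map _ _ measurable_id measurable_snd]
      simp
    rw [h1, Measure.map_map (by fun_prop) (by fun_prop)]
    rfl
  · rw [Measure.map_map hf (by fun_prop)]
    congr 1
    ext ω i j
    simp only [f, Function.comp, MM, Pi.add_apply, add_mul, mul_add, Finset.sum_add_distrib,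
      Finset.mul_sum]
    rw [add_assoc]
    congr 2
    exact Finset.sum_congr rfl fun k _ => by ring

theorem statement15 (n l s d : ℕ) (hn : 1 ≤ n) (hl : 1 ≤ l) (hs : 1 ≤ s) (hsd : s < d)
    (σ : ℝ) (hσ : 0 < σ) (v : Matrix (Fin n) (Fin s) ℝ) :
    KLdiv
      -- law of σ√(d−s) G + v Z'
      (Measure.map
        (fun ω : Matrix (Fin n) (Fin l) ℝ × Matrix (Fin s) (Fin l) ℝ =>
          (σ * Real.sqrt ((d : ℝ) - s)) • ω.1 + v * ω.2)
        ((stdGaussianMatrix n l).prod (stdGaussianMatrix s l)))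
      -- law of σ√(d−s) G + (σ N + v) Z
      (Measure.map
        (fun ω : Matrix (Fin n) (Fin l) ℝ × Matrix (Fin n) (Fin s) ℝ × Matrix (Fin s) (Fin l) ℝ =>
          (σ * Real.sqrt ((d : ℝ) - s)) • ω.1 + (σ • ω.2.1 + v) * ω.2.2)
        ((stdGaussianMatrix n l).prod ((stdGaussianMatrix n s).prod (stdGaussianMatrix s l)))) ≤
    ENNReal.ofReal ((n * l * s : ℝ) / (2 * ((d : ℝ) - s))) := by
  have hds : (0 : ℝ) < (d : ℝ) - s := sub_pos.2 (by exact_mod_cast hsd)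
  have hr : 0 < Real.sqrt ((d : ℝ) - s) := Real.sqrt_pos.2 hds
  have h := main_aux n l s (σ * Real.sqrt ((d : ℝ) - s)) (Real.sqrt ((d : ℝ) - s))⁻¹ v
  have e1 : σ * Real.sqrt ((d : ℝ) - s) * (Real.sqrt ((d : ℝ) - s))⁻¹ = σ := by
    field_simp
  have e2 : (n * l * s : ℝ) * ((Real.sqrt ((d : ℝ) - s))⁻¹) ^ 2 / 2
      = (n * l * s : ℝ) / (2 * ((d : ℝ) - s)) := by
    rw [inv_pow, Real.sq_sqrt hds.le]
    field_simp
  rw [e1, e2] at h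
  exact h

end Paper
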